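/- arXiv:math/0701122 — 3 statements merged into one kernel-verified Lean document; each statement's English description precedes it below -/
import Mathlib

section
/- Let p, q, p', q' be integers with (p,q) ≠ (p',q'), and set λ = (1,p,q) and μ = (1,p',q') in ℤ³. Then the following are equivalent: (i) for all real numbers a₁, a₂, if a₁·λ + a₂·μ ∈ ℤ³ (i.e. every component of a₁λ + a₂μ is an integer) then a₁ ∈ ℤ and a₂ ∈ ℤ; (ii) gcd(p'−p, q'−q) = 1. -/
/-- For `λ = (1,p,q)` and `μ = (1,p',q')` in `ℤ³` with `(p,q) ≠ (p',q')`,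
the integrality condition "`a₁·λ + a₂·μ ∈ ℤ³` implies `a₁, a₂ ∈ ℤ`" (for all real `a₁, a₂`)
holds if and only if `gcd(p'−p, q'−q) = 1`. -/
theorem stmt_0 (p q p' q' : ℤ) (hne : (p, q) ≠ (p', q')) :
    (∀ a₁ a₂ : ℝ,
        (∀ i : Fin 3,
          ∃ k : ℤ,
            a₁ * (![(1 : ℤ), p, q] i : ℝ) + a₂ * (![(1 : ℤ), p', q'] i : ℝ) = (k : ℝ)) →
        (∃ k : ℤ, a₁ = (k : ℝ)) ∧ (∃ k : ℤ, a₂ = (k : ℝ)))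
      ↔ Int.gcd (p' - p) (q' - q) = 1 := by
  constructor
  · intro h
    have hd : ((Int.gcd (p' - p) (q' - q) : ℤ) : ℝ) ≠ 0 := by
      norm_cast
      rw [Int.gcd_eq_zero_iff]
      rintro ⟨hp, hq⟩
      exact hne (Prod.ext (by simp; omega) (by simp; omega))
    obtain ⟨u, hu⟩ := Int.gcd_dvd_left (p' - p) (q' - q)
    obtain ⟨v, hv⟩ := Int.gcd_dvd_right (p' - p) (q' - q)
    generalize Int.gcd (p' - p) (q' - q) = d at *
    have hu' : (p' : ℝ) - p = ((d : ℤ) : ℝ) * u := mod_cast hu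
    have hv' : (q' : ℝ) - q = ((d : ℤ) : ℝ) * v := mod_cast hv
    obtain ⟨-, k, hk⟩ := h (-(1 / ((d : ℤ) : ℝ))) (1 / ((d : ℤ) : ℝ)) (by
      intro i
      fin_cases i
      · exact ⟨0, by simp⟩
      · refine ⟨u, ?_⟩
        simp only [Fin.mk_one, Matrix.cons_val_one, Matrix.cons_val_zero]
        field_simp
        linear_combination hu'
      · refine ⟨v, ?_⟩
        simp only [Fin.reduceFinMk, Matrix.cons_val]
        field_simp
        linear_combination hv')
    rw [div_eq_iff hd] at hk
    have hkd : (1 : ℤ) = k * d := mod_cast hk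
    exact_mod_cast Int.natCast_dvd_natCast.mp (Dvd.intro_left k hkd.symm) |> Nat.dvd_one.mp
  · intro h a₁ a₂ ha
    obtain ⟨k₀, h₀⟩ := ha 0
    obtain ⟨k₁, h₁⟩ := ha 1
    obtain ⟨k₂, h₂⟩ := ha 2
    simp only [Matrix.cons_val, Int.cast_one, mul_one] at h₀ h₁ h₂
    have hb := Int.gcd_eq_gcd_ab (p' - p) (q' - q)
    rw [h] at hb
    generalize Int.gcdA (p' - p) (q' - q) = x at hb
    generalize Int.gcdB (p' - p) (q' - q) = y at hb
    have hb' : (1 : ℝ) = (p' - p) * x + (q' - q) * y := mod_cast hb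
    have h_a₂ : a₂ = ((x * (k₁ - k₀ * p) + y * (k₂ - k₀ * q) : ℤ) : ℝ) := by
      push_cast
      linear_combination a₂ * hb' + x * (h₁ - p * h₀) + y * (h₂ - q * h₀)
    refine ⟨⟨k₀ - (x * (k₁ - k₀ * p) + y * (k₂ - k₀ * q)), ?_⟩, _, h_a₂⟩
    rw [Int.cast_sub, ← h_a₂]
    linear_combination h₀
end

section
/- Let n ≥ 1, let ℓ ≥ 2 be an integer, let γ ∈ ℚⁿ be such that ℓγ ∈ ℤⁿ and ℓγ is primitive (the gcd of its components is 1), and let λ₁, …, λ_d ∈ ℤⁿ satisfy ⟨γ, λᵢ⟩ = −1 for every i, where ⟨γ, λ⟩ = Σⱼ γⱼλⱼ. Then the subgroup (ℤ-submodule) of ℤⁿ generated by λ₁, …, λ_d is a proper subgroup of ℤⁿ. -/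
/-- If `m` divides the pairing of `w` with every element of `s`, then it divides the pairing of `w`
with every element of the subgroup generated by `s`. -/
theorem dvd_dotProduct_of_mem_span {ι : Type*} [Fintype ι] {m : ℤ} {w : ι → ℤ} {s : Set (ι → ℤ)}
    (h : ∀ v ∈ s, m ∣ w ⬝ᵥ v) {v : ι → ℤ} (hv : v ∈ Submodule.span ℤ s) : m ∣ w ⬝ᵥ v := by
  induction hv using Submodule.span_induction with
  | mem v hv => exact h v hv
  | zero => simp
  | add x y _ _ hx hy => rw [dotProduct_add]; exact dvd_add hx hy
  | smul a x _ hx => rw [dotProduct_smul]; exact hx.mul_left a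

/-- If the generators of `ℤ^ι` all pair with `w` to a multiple of `m`, then `m` divides the gcd of
the components of `w`. -/
theorem dvd_gcd_of_span_eq_top {ι : Type*} [Fintype ι] {m : ℤ} {w : ι → ℤ} {s : Set (ι → ℤ)}
    (h : ∀ v ∈ s, m ∣ w ⬝ᵥ v) (hs : Submodule.span ℤ s = ⊤) : m ∣ Finset.univ.gcd w := by
  classical
  refine Finset.dvd_gcd fun j _ => ?_
  have hj : m ∣ w ⬝ᵥ Pi.single j 1 := dvd_dotProduct_of_mem_span h (hs ▸ Submodule.mem_top)
  simpa using hj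

/-- If `ℓ ≥ 2`, `γ ∈ ℚⁿ` with `ℓγ ∈ ℤⁿ` primitive, and `⟨γ, λᵢ⟩ = −1` for all
`i`, then the subgroup of `ℤⁿ` generated by `λ₁, …, λ_d` is a proper subgroup of `ℤⁿ`. -/
theorem stmt_4 (n : ℕ) (hn : 1 ≤ n) (ℓ : ℕ) (hℓ : 2 ≤ ℓ)
    (γ : Fin n → ℚ) (w : Fin n → ℤ)
    (hw : ∀ j : Fin n, (w j : ℚ) = (ℓ : ℚ) * γ j)
    (hprim : Finset.univ.gcd w = 1)
    (d : ℕ) (lam : Fin d → Fin n → ℤ)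
    (hpair : ∀ i : Fin d, ∑ j : Fin n, γ j * (lam i j : ℚ) = -1) :
    Submodule.span ℤ (Set.range lam) ≠ (⊤ : Submodule ℤ (Fin n → ℤ)) := by
  intro htop
  have hdot (i : Fin d) : w ⬝ᵥ lam i = -ℓ := by
    have hq : ((w ⬝ᵥ lam i : ℤ) : ℚ) = ℓ * ∑ j, γ j * (lam i j : ℚ) := by
      simp [dotProduct, hw, Finset.mul_sum, mul_assoc]
    rw [hpair i] at hq
    exact_mod_cast hq.trans (mul_neg_one _)
  have hdvd : (ℓ : ℤ) ∣ Finset.univ.gcd w := by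
    refine dvd_gcd_of_span_eq_top ?_ htop
    rintro _ ⟨i, rfl⟩
    simp [hdot i]
  rw [hprim] at hdvd
  have := Int.le_of_dvd one_pos hdvd
  lia
end

section
/- Let F, G : ℝ × ℝⁿ → ℝ be smooth functions such that for every (t,x) the Hessian matrix Hessₓ F(t,x) of F in the ℝⁿ-variable is invertible, and such that the Legendre relation G(t, ∇ₓF(t,x)) = ⟨x, ∇ₓF(t,x)⟩ − F(t,x) holds for all (t,x). Then for all (t,x), with y = ∇ₓF(t,x): (∂²F/∂t²)(t,x) − ⟨(Hessₓ F(t,x))⁻¹ · ∇ₓ(∂F/∂t)(t,x), ∇ₓ(∂F/∂t)(t,x)⟩ = −(∂²G/∂t²)(t,y). In particular, F satisfies the geodesic equation F̈ − ½|dḞ|² = 0 at (t,x) if and only if (∂²G/∂t²)(t, ∇ₓF(t,x)) = 0. -/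
/-- The partial derivative `∂F/∂t` of `F : ℝ × ℝⁿ → ℝ` in the first (time) variable. -/
noncomputable def tDeriv (n : ℕ) (F : ℝ × (Fin n → ℝ) → ℝ) (p : ℝ × (Fin n → ℝ)) : ℝ :=
  fderiv ℝ F p (1, 0)

/-- The gradient `∇ₓF` of `F : ℝ × ℝⁿ → ℝ` in the `ℝⁿ`-variable. -/
noncomputable def xGrad (n : ℕ) (F : ℝ × (Fin n → ℝ) → ℝ) (p : ℝ × (Fin n → ℝ)) :
    Fin n → ℝ :=
  fun i => fderiv ℝ F p (0, Pi.single i 1)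

/-- The Hessian matrix `Hessₓ F` of `F : ℝ × ℝⁿ → ℝ` in the `ℝⁿ`-variable. -/
noncomputable def xHess (n : ℕ) (F : ℝ × (Fin n → ℝ) → ℝ) (p : ℝ × (Fin n → ℝ)) :
    Matrix (Fin n) (Fin n) ℝ :=
  fun i j => fderiv ℝ (fun q => xGrad n F q j) p (0, Pi.single i 1)

theorem ContDiff.fderiv_apply_const {E : Type*} [NormedAddCommGroup E] [NormedSpace ℝ E]
    {F : E → ℝ} (hF : ContDiff ℝ (⊤ : ℕ∞) F) (w : E) :
    ContDiff ℝ (⊤ : ℕ∞) (fun q => fderiv ℝ F q w) :=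
  (hF.fderiv_right (m := ((⊤ : ℕ∞) : WithTop ℕ∞)) (by simp)).clm_apply contDiff_const

theorem ContDiff.fderiv_fderiv_apply_comm {E : Type*} [NormedAddCommGroup E] [NormedSpace ℝ E]
    {F : E → ℝ} (hF : ContDiff ℝ (⊤ : ℕ∞) F) (p v w : E) :
    fderiv ℝ (fun q => fderiv ℝ F q w) p v = fderiv ℝ (fun q => fderiv ℝ F q v) p w := by
  have hd : DifferentiableAt ℝ (fderiv ℝ F) p :=
    ((hF.fderiv_right (m := ((⊤ : ℕ∞) : WithTop ℕ∞)) (by simp)).differentiable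
      (by simp)).differentiableAt
  have hsymm : IsSymmSndFDerivAt ℝ F p :=
    hF.contDiffAt.isSymmSndFDerivAt (by simpa using WithTop.coe_le_coe.2 (le_top : (2 : ℕ∞) ≤ ⊤))
  have key : ∀ u u' : E,
      fderiv ℝ (fun q => fderiv ℝ F q u) p u' = fderiv ℝ (fderiv ℝ F) p u' u := by
    intro u u'
    rw [fderiv_clm_apply hd (differentiableAt_const u)]
    simp
  rw [key, key, hsymm.eq]

theorem fderiv_apply_eq_tDeriv_add_sum_xGrad (n : ℕ) (K : ℝ × (Fin n → ℝ) → ℝ)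
    (q : ℝ × (Fin n → ℝ)) (s : ℝ) (u : Fin n → ℝ) :
    fderiv ℝ K q (s, u) = s * tDeriv n K q + ∑ j, xGrad n K q j * u j := by
  have h : (s, u) = s • ((1 : ℝ), (0 : Fin n → ℝ)) +
      ∑ j, u j • ((0 : ℝ), (Pi.single j (1 : ℝ) : Fin n → ℝ)) := by
    ext k
    · simp [Prod.fst_sum]
    · simp [Prod.snd_sum, Finset.sum_apply, Pi.single_apply]
  rw [h, map_add, map_sum, map_smul]
  simp only [map_smul, smul_eq_mul, tDeriv, xGrad, mul_comm]

/-- Chain rule for `q ↦ K (q.1, f q)`, in terms of `tDeriv` and `xGrad`. -/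
theorem fderiv_comp_fst_prodMk (n : ℕ) {K : ℝ × (Fin n → ℝ) → ℝ}
    {f : ℝ × (Fin n → ℝ) → Fin n → ℝ} (hK : Differentiable ℝ K)
    (hf : ∀ j, Differentiable ℝ (fun q => f q j)) (p v : ℝ × (Fin n → ℝ)) :
    fderiv ℝ (fun q : ℝ × (Fin n → ℝ) => K (q.1, f q)) p v =
      v.1 * tDeriv n K (p.1, f p) +
        ∑ j, xGrad n K (p.1, f p) j * fderiv ℝ (fun q => f q j) p v := by
  have h2 : HasFDerivAt f (ContinuousLinearMap.pi fun j => fderiv ℝ (fun q => f q j) p) p :=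
    hasFDerivAt_pi.2 fun j => (hf j p).hasFDerivAt
  have h := (hK (p.1, f p)).hasFDerivAt.comp p ((hasFDerivAt_fst (p := p)).prodMk h2)
  have h' : fderiv ℝ (fun q : ℝ × (Fin n → ℝ) => K (q.1, f q)) p = _ := h.fderiv
  rw [h']
  exact fderiv_apply_eq_tDeriv_add_sum_xGrad n K _ _ _

theorem fderiv_sum_snd_mul_sub (n : ℕ) {F : ℝ × (Fin n → ℝ) → ℝ}
    {f : ℝ × (Fin n → ℝ) → Fin n → ℝ} (hF : Differentiable ℝ F)
    (hf : ∀ j, Differentiable ℝ (fun q => f q j)) (p v : ℝ × (Fin n → ℝ)) :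
    fderiv ℝ (fun q : ℝ × (Fin n → ℝ) => (∑ j, q.2 j * f q j) - F q) p v =
      (∑ j, (p.2 j * fderiv ℝ (fun q => f q j) p v + f p j * v.2 j)) - fderiv ℝ F p v := by
  have hc : ∀ j : Fin n, HasFDerivAt (fun q : ℝ × (Fin n → ℝ) => q.2 j)
      ((ContinuousLinearMap.proj (R := ℝ) (φ := fun _ : Fin n => ℝ) j).comp
        (ContinuousLinearMap.snd ℝ ℝ (Fin n → ℝ))) p := fun j =>
    ((ContinuousLinearMap.proj (R := ℝ) (φ := fun _ : Fin n => ℝ) j).comp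
        (ContinuousLinearMap.snd ℝ ℝ (Fin n → ℝ))).hasFDerivAt
  have h := (HasFDerivAt.fun_sum (u := Finset.univ)
    fun j _ => (hc j).mul (hf j p).hasFDerivAt).fun_sub (hF p).hasFDerivAt
  have h' : fderiv ℝ (fun q : ℝ × (Fin n → ℝ) => (∑ j, q.2 j * f q j) - F q) p = _ := h.fderiv
  rw [h']
  simp

section Legendre

variable {n : ℕ} {F G : ℝ × (Fin n → ℝ) → ℝ}

theorem differentiable_xGrad_apply (hF : ContDiff ℝ (⊤ : ℕ∞) F) (j : Fin n) :
    Differentiable ℝ (fun q => xGrad n F q j) :=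
  (hF.fderiv_apply_const _).differentiable (by simp)

theorem fderiv_legendre (hF : ContDiff ℝ (⊤ : ℕ∞) F) (hG : ContDiff ℝ (⊤ : ℕ∞) G)
    (hLeg : ∀ (t : ℝ) (x : Fin n → ℝ),
      G (t, xGrad n F (t, x)) = (∑ i : Fin n, x i * xGrad n F (t, x) i) - F (t, x))
    (p v : ℝ × (Fin n → ℝ)) :
    v.1 * tDeriv n G (p.1, xGrad n F p) +
        ∑ j, xGrad n G (p.1, xGrad n F p) j * fderiv ℝ (fun q => xGrad n F q j) p v =
      (∑ j, p.2 j * fderiv ℝ (fun q => xGrad n F q j) p v) - v.1 * tDeriv n F p := by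
  have hfun : (fun q : ℝ × (Fin n → ℝ) => G (q.1, xGrad n F q)) =
      fun q => (∑ j, q.2 j * xGrad n F q j) - F q := funext fun q => hLeg q.1 q.2
  have h := congrArg (fun K => fderiv ℝ K p v) hfun
  rw [fderiv_comp_fst_prodMk n (hG.differentiable (by simp)) (differentiable_xGrad_apply hF),
    fderiv_sum_snd_mul_sub n (hF.differentiable (by simp)) (differentiable_xGrad_apply hF)] at h
  rw [h, show fderiv ℝ F p v = _ from fderiv_apply_eq_tDeriv_add_sum_xGrad n F p v.1 v.2,
    Finset.sum_add_distrib]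
  ring

/-- The gradients of a function and of its Legendre transform are inverse to each other. -/
theorem xGrad_legendre (hF : ContDiff ℝ (⊤ : ℕ∞) F) (hG : ContDiff ℝ (⊤ : ℕ∞) G)
    (hHess : ∀ p : ℝ × (Fin n → ℝ), IsUnit (xHess n F p))
    (hLeg : ∀ (t : ℝ) (x : Fin n → ℝ),
      G (t, xGrad n F (t, x)) = (∑ i : Fin n, x i * xGrad n F (t, x) i) - F (t, x))
    (p : ℝ × (Fin n → ℝ)) : xGrad n G (p.1, xGrad n F p) = p.2 := by
  refine Matrix.mulVec_injective_of_isUnit (hHess p) (funext fun i => ?_)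
  have h := fderiv_legendre hF hG hLeg p (0, Pi.single i 1)
  simpa [Matrix.mulVec, dotProduct, xHess, mul_comm] using h

theorem tDeriv_legendre (hF : ContDiff ℝ (⊤ : ℕ∞) F) (hG : ContDiff ℝ (⊤ : ℕ∞) G)
    (hHess : ∀ p : ℝ × (Fin n → ℝ), IsUnit (xHess n F p))
    (hLeg : ∀ (t : ℝ) (x : Fin n → ℝ),
      G (t, xGrad n F (t, x)) = (∑ i : Fin n, x i * xGrad n F (t, x) i) - F (t, x))
    (p : ℝ × (Fin n → ℝ)) : tDeriv n G (p.1, xGrad n F p) = - tDeriv n F p := by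
  have h := fderiv_legendre hF hG hLeg p (1, 0)
  rw [xGrad_legendre hF hG hHess hLeg] at h
  simp only [one_mul] at h
  linarith

end Legendre

/-- If `F, G : ℝ × ℝⁿ → ℝ` are smooth, `Hessₓ F` is invertible everywhere, and
the Legendre relation `G(t, ∇ₓF(t,x)) = ⟨x, ∇ₓF(t,x)⟩ − F(t,x)` holds, then (with
`y = ∇ₓF(t,x)`) we have `F̈(t,x) − ⟨(Hessₓ F)⁻¹ ∇ₓḞ, ∇ₓḞ⟩ = −G̈(t,y)`; in particular
the geodesic equation `F̈ − ½|dḞ|² = 0` holds at `(t,x)` iff `G̈(t,y) = 0`. -/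
theorem stmt_9 (n : ℕ) (F G : ℝ × (Fin n → ℝ) → ℝ)
    (hF : ContDiff ℝ (⊤ : ℕ∞) F) (hG : ContDiff ℝ (⊤ : ℕ∞) G)
    (hHess : ∀ p : ℝ × (Fin n → ℝ), IsUnit (xHess n F p))
    (hLeg : ∀ (t : ℝ) (x : Fin n → ℝ),
      G (t, xGrad n F (t, x)) = (∑ i : Fin n, x i * xGrad n F (t, x) i) - F (t, x)) :
    ∀ (t : ℝ) (x : Fin n → ℝ),
      (tDeriv n (tDeriv n F) (t, x) -
          ∑ i : Fin n,
            ((xHess n F (t, x))⁻¹.mulVec (xGrad n (tDeriv n F) (t, x))) i *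
              xGrad n (tDeriv n F) (t, x) i
        = - tDeriv n (tDeriv n G) (t, xGrad n F (t, x))) ∧
      (tDeriv n (tDeriv n F) (t, x) -
          ∑ i : Fin n,
            ((xHess n F (t, x))⁻¹.mulVec (xGrad n (tDeriv n F) (t, x))) i *
              xGrad n (tDeriv n F) (t, x) i = 0
        ↔ tDeriv n (tDeriv n G) (t, xGrad n F (t, x)) = 0) := by
  intro t x
  have hdiff : ∀ v : ℝ × (Fin n → ℝ),
      v.1 * tDeriv n (tDeriv n G) (t, xGrad n F (t, x)) +
        ∑ j, xGrad n (tDeriv n G) (t, xGrad n F (t, x)) j *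
          fderiv ℝ (fun q => xGrad n F q j) (t, x) v = - fderiv ℝ (tDeriv n F) (t, x) v := by
    intro v
    have hfun : (fun q : ℝ × (Fin n → ℝ) => tDeriv n G (q.1, xGrad n F q)) =
        fun q => - tDeriv n F q := funext (tDeriv_legendre hF hG hHess hLeg)
    have h := fderiv_comp_fst_prodMk n (K := tDeriv n G)
      ((hG.fderiv_apply_const (1, 0)).differentiable (by simp))
      (differentiable_xGrad_apply hF) (t, x) v
    rw [← h, hfun, fderiv_fun_neg]
    rfl
  have hx : (xHess n F (t, x)).mulVec (xGrad n (tDeriv n G) (t, xGrad n F (t, x))) =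
      - xGrad n (tDeriv n F) (t, x) := by
    funext i
    have h := hdiff (0, Pi.single i 1)
    simpa [Matrix.mulVec, dotProduct, xHess, xGrad, mul_comm] using h
  have hinv : (xHess n F (t, x))⁻¹.mulVec (xGrad n (tDeriv n F) (t, x)) =
      - xGrad n (tDeriv n G) (t, xGrad n F (t, x)) := by
    rw [eq_neg_iff_add_eq_zero, ← neg_eq_iff_add_eq_zero, ← Matrix.mulVec_neg, ← hx,
      Matrix.mulVec_mulVec, Matrix.nonsing_inv_mul _
        ((Matrix.isUnit_iff_isUnit_det _).1 (hHess (t, x))), Matrix.one_mulVec]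
  have hcomm : ∀ j, fderiv ℝ (fun q => xGrad n F q j) (t, x) (1, 0) =
      xGrad n (tDeriv n F) (t, x) j :=
    fun j => hF.fderiv_fderiv_apply_comm (t, x) (1, 0) (0, Pi.single j 1)
  have ht := hdiff (1, 0)
  simp only [hcomm, one_mul] at ht
  have hmain : tDeriv n (tDeriv n F) (t, x) -
      ∑ i : Fin n,
        ((xHess n F (t, x))⁻¹.mulVec (xGrad n (tDeriv n F) (t, x))) i *
          xGrad n (tDeriv n F) (t, x) i
      = - tDeriv n (tDeriv n G) (t, xGrad n F (t, x)) := by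
    rw [hinv]
    simp only [Pi.neg_apply, neg_mul, Finset.sum_neg_distrib]
    change _ = - fderiv ℝ (tDeriv n F) (t, x) (1, 0) at ht
    change fderiv ℝ (tDeriv n F) (t, x) (1, 0) - _ = _
    linarith
  exact ⟨hmain, by rw [hmain, neg_eq_zero]⟩
end
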